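/- arXiv:2208.03439 — 2 statements merged into one kernel-verified Lean document; each statement's English description precedes it below -/
import Mathlib

section
/- (Proposition A, C¹ version.) Let n ≥ 2, let u : ℝⁿ → ℝ be continuously differentiable and let f : ℝⁿ → ℝ be continuous. Suppose that for every smooth compactly supported φ : ℝⁿ → ℝ, ∫_{ℝⁿ} ⟨M∇u, ∇φ⟩ dx = ∫_{ℝⁿ} f φ dx. Define q(x) = ⟨Mx, x⟩, T_H(x) = Mx/q(x), and û(x) = u(T_H(x)) · q(x)^{-(n-2)/2} on ℝⁿ \ {0}. Then for every smooth φ : ℝⁿ → ℝ whose compact support is contained in ℝⁿ \ {0}, ∫_{ℝⁿ} ⟨M⁻¹∇û, ∇φ⟩ dx = ∫_{ℝⁿ} (f(T_H(x)) / q(x)^{(n+2)/2}) φ(x) dx; that is, û weakly solves −Δ^{H*} û = (f ∘ T_H)/H^{n+2} in ℝⁿ \ {0}. -/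
open MeasureTheory
open scoped RealInnerProductSpace

namespace AnisotropicKelvin

variable {E : Type*} [NormedAddCommGroup E] [InnerProductSpace ℝ E]

/-- `A` is symmetric and positive definite, with inverse `B`. -/
structure IsPosInversePair (A B : E →L[ℝ] E) : Prop where
  symm : ∀ x y, ⟪A x, y⟫ = ⟪x, A y⟫
  pos : ∀ x, x ≠ 0 → 0 < ⟪A x, x⟫
  left_inv : ∀ x, B (A x) = x
  right_inv : ∀ x, A (B x) = x

/-- The anisotropic inversion `x ↦ A x / ⟪A x, x⟫`. -/
noncomputable def inversion (A : E →L[ℝ] E) (x : E) : E := (⟪A x, x⟫)⁻¹ • A x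

/-- The anisotropic Kelvin transform of `h` with weight `⟪A x, x⟫ ^ (-s)`. -/
noncomputable def kelvin (A : E →L[ℝ] E) (s : ℝ) (h : E → ℝ) (x : E) : ℝ :=
  h (inversion A x) * ⟪A x, x⟫ ^ (-s)

/-- The derivative of the anisotropic inversion away from the origin. -/
noncomputable def inversionDeriv (A : E →L[ℝ] E) (x : E) : E →L[ℝ] E :=
  (⟪A x, x⟫)⁻¹ • A.comp
    (ContinuousLinearMap.id ℝ E - (2 * (⟪A x, x⟫)⁻¹) • (innerSL ℝ (A x)).smulRight x)

lemma inversionDeriv_apply (A : E →L[ℝ] E) (x v : E) :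
    inversionDeriv A x v = (⟪A x, x⟫)⁻¹ • (A v - (2 * (⟪A x, x⟫)⁻¹ * ⟪A x, v⟫) • A x) := by
  simp [inversionDeriv, smul_smul, mul_assoc]

@[simp] lemma inversion_zero (A : E →L[ℝ] E) : inversion A 0 = 0 := by simp [inversion]

lemma continuous_gradient [CompleteSpace E] {g : E → ℝ} (hg : ContDiff ℝ 1 g) :
    Continuous (gradient g) :=
  (InnerProductSpace.toDual ℝ E).symm.continuous.comp (hg.continuous_fderiv one_ne_zero)

lemma hasCompactSupport_gradient [CompleteSpace E] {g : E → ℝ} (hg : HasCompactSupport g) :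
    HasCompactSupport (gradient g) :=
  (hg.fderiv ℝ).comp_left (g := (InnerProductSpace.toDual ℝ E).symm) (map_zero _)

section EulerField

variable [FiniteDimensional ℝ E] [MeasurableSpace E] [BorelSpace E]

lemma integrable_inner_gradient {g : E → ℝ} (hg : ContDiff ℝ 1 g) (hc : HasCompactSupport g) :
    Integrable (fun x => ⟪x, gradient g x⟫) :=
  (continuous_id.inner (continuous_gradient hg)).integrable_of_hasCompactSupport
    ((hasCompactSupport_gradient hc).mono fun x hx h0 => hx (by simp [h0]))

/-- Integration by parts against the Euler vector field. -/
lemma integral_inner_gradient {g : E → ℝ} (hg : ContDiff ℝ 1 g) (hc : HasCompactSupport g) :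
    ∫ x, ⟪x, gradient g x⟫ = -(Module.finrank ℝ E * ∫ x, g x) := by
  let b := stdOrthonormalBasis ℝ E
  have hgi : Integrable g := hg.continuous.integrable_of_hasCompactSupport hc
  have hint (i) : Integrable (fun x => ⟪b i, x⟫ * fderiv ℝ g x (b i)) :=
    ((continuous_const.inner continuous_id).mul
      ((hg.continuous_fderiv one_ne_zero).clm_apply continuous_const)).integrable_of_hasCompactSupport
      ((hc.fderiv_apply ℝ (b i)).mul_left)
  have hfd (i) (x : E) : fderiv ℝ (fun y => ⟪b i, y⟫) x = innerSL ℝ (b i) :=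
    (innerSL ℝ (b i)).fderiv
  have hone (i) (x : E) : fderiv ℝ (fun y => ⟪b i, y⟫) x (b i) = 1 := by
    simp [hfd, b.orthonormal.1 i]
  have hibp (i) : ∫ x, ⟪b i, x⟫ * fderiv ℝ g x (b i) = - ∫ x, g x := by
    rw [integral_mul_fderiv_eq_neg_fderiv_mul_of_integrable (f := fun x => ⟪b i, x⟫)
      (by simpa [hone] using hgi) (hint i)
      (((continuous_const.inner continuous_id).mul
        hg.continuous).integrable_of_hasCompactSupport hc.mul_left)
      (fun x _ => (innerSL ℝ (b i)).differentiableAt)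
      (fun x _ => hg.differentiable one_ne_zero x)]
    simp [hone]
  have hsum (x : E) : ⟪x, gradient g x⟫ = ∑ i, ⟪b i, x⟫ * fderiv ℝ g x (b i) := by
    rw [← b.sum_inner_mul_inner x (gradient g x)]
    refine Finset.sum_congr rfl fun i _ => ?_
    rw [real_inner_comm, real_inner_comm (gradient g x), ← toDual_gradient,
      InnerProductSpace.toDual_apply_apply]
  simp_rw [hsum]
  rw [integral_finsetSum _ fun i _ => hint i]
  simp [hibp]

end EulerField

namespace IsPosInversePair

variable {A B : E →L[ℝ] E} (h : IsPosInversePair A B)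
include h

lemma swap : IsPosInversePair B A where
  symm x y := by rw [← h.right_inv y, ← h.symm, h.right_inv, h.left_inv]
  pos x hx := by
    have hB : B x ≠ 0 := fun h0 => hx (by rw [← h.right_inv x, h0, map_zero])
    have := h.pos _ hB
    rwa [h.right_inv, real_inner_comm] at this
  left_inv := h.right_inv
  right_inv := h.left_inv

lemma apply_ne_zero {x : E} (hx : x ≠ 0) : A x ≠ 0 := fun h0 =>
  hx (by rw [← h.left_inv x, h0, map_zero])

lemma inner_inversion (x : E) : ⟪B (inversion A x), inversion A x⟫ = (⟪A x, x⟫)⁻¹ := by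
  rcases eq_or_ne x 0 with rfl | hx
  · simp
  have := (h.pos x hx).ne'
  simp only [inversion, map_smul, h.left_inv, inner_smul_left, inner_smul_right,
    real_inner_comm (A x) x, conj_trivial]
  field_simp

lemma inversion_inversion (x : E) : inversion B (inversion A x) = x := by
  rcases eq_or_ne x 0 with rfl | hx
  · simp
  have := (h.pos x hx).ne'
  rw [inversion, h.inner_inversion]
  simp [inversion, h.left_inv, smul_smul, this]

lemma inversion_ne_zero {x : E} (hx : x ≠ 0) : inversion A x ≠ 0 := fun h0 =>
  hx (by rw [← h.inversion_inversion x, h0, inversion_zero])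

lemma inversion_injective : Function.Injective (inversion A) := fun x y hxy => by
  rw [← h.inversion_inversion x, hxy, h.inversion_inversion]

lemma image_inversion : inversion A '' {0}ᶜ = ({0}ᶜ : Set E) := by
  ext y
  constructor
  · rintro ⟨x, hx, rfl⟩
    exact h.inversion_ne_zero hx
  · intro hy
    exact ⟨inversion B y, h.swap.inversion_ne_zero hy, h.swap.inversion_inversion y⟩

lemma contDiffAt_inversion {x : E} (hx : x ≠ 0) {k : WithTop ℕ∞} :
    ContDiffAt ℝ k (inversion A) x :=
  ((A.contDiff.inner ℝ contDiff_id).contDiffAt.inv (h.pos x hx).ne').smul A.contDiff.contDiffAt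

lemma contDiffAt_kelvin {x : E} (hx : x ≠ 0) {k : WithTop ℕ∞} (s : ℝ) {g : E → ℝ}
    (hg : ContDiff ℝ k g) : ContDiffAt ℝ k (kelvin A s g) x :=
  (hg.contDiffAt.comp x (h.contDiffAt_inversion hx)).mul
    ((A.contDiff.inner ℝ contDiff_id).contDiffAt.rpow_const_of_ne (h.pos x hx).ne')

lemma kelvin_kelvin (s : ℝ) {g : E → ℝ} (hg : g 0 = 0) : kelvin A s (kelvin B s g) = g := by
  ext x
  rcases eq_or_ne x 0 with rfl | hx
  · simp [kelvin, hg]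
  have hq := h.pos x hx
  rw [kelvin, kelvin, h.inversion_inversion, h.inner_inversion, mul_assoc,
    Real.inv_rpow hq.le, inv_mul_cancel₀ (Real.rpow_pos_of_pos hq _).ne', mul_one]

lemma hasFDerivAt_inner {x : E} :
    HasFDerivAt (fun y => ⟪A y, y⟫) ((2 : ℝ) • innerSL ℝ (A x)) x := by
  refine (A.hasFDerivAt.inner ℝ (hasFDerivAt_id x)).congr_fderiv ?_
  ext v
  simp [two_mul, fderivInnerCLM_apply, h.symm v x, real_inner_comm]

lemma hasFDerivAt_inversion {x : E} (hx : x ≠ 0) :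
    HasFDerivAt (inversion A) (inversionDeriv A x) x := by
  have hq := (h.pos x hx).ne'
  refine (((hasDerivAt_inv hq).comp_hasFDerivAt (f := fun y => ⟪A y, y⟫) x h.hasFDerivAt_inner).smul
    (A.hasFDerivAt (x := x))).congr_fderiv ?_
  ext v
  rw [inversionDeriv_apply]
  simp [smul_sub, smul_smul]
  module

lemma hasGradientAt_kelvin [CompleteSpace E] {x : E} (hx : x ≠ 0) (s : ℝ) {g : E → ℝ}
    (hg : DifferentiableAt ℝ g (inversion A x)) :
    HasGradientAt (kelvin A s g)
      (⟪A x, x⟫ ^ (-s - 1) • (A (gradient g (inversion A x))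
        - (2 * (⟪A x, x⟫)⁻¹ * ⟪A x, gradient g (inversion A x)⟫) • A x
        - (2 * s * g (inversion A x)) • A x)) x := by
  have hq := h.pos x hx
  rw [hasGradientAt_iff_hasFDerivAt]
  refine ((hg.hasGradientAt.hasFDerivAt.comp x (h.hasFDerivAt_inversion hx)).mul
    ((h.hasFDerivAt_inner (x := x)).rpow_const (p := -s) (Or.inl hq.ne'))).congr_fderiv ?_
  ext v
  have e : ⟪A x, x⟫ ^ (-s) = ⟪A x, x⟫ ^ (-s - 1) * ⟪A x, x⟫ := by
    rw [Real.rpow_sub_one hq.ne']; field_simp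
  simp only [add_apply, smul_apply,
    ContinuousLinearMap.comp_apply, InnerProductSpace.toDual_apply_apply, innerSL_apply_apply,
    Function.comp_apply, inversionDeriv_apply, inner_sub_left, inner_sub_right, inner_smul_left,
    inner_smul_right, conj_trivial, smul_eq_mul, e, h.symm (gradient g (inversion A x)) v,
    real_inner_comm (A x) (gradient g (inversion A x))]
  field_simp
  ring

lemma hasCompactSupport_kelvin (s : ℝ) {g : E → ℝ} (hc : HasCompactSupport g)
    (h0 : tsupport g ⊆ {0}ᶜ) : HasCompactSupport (kelvin A s g) ∧ tsupport (kelvin A s g) ⊆ {0}ᶜ := by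
  have hK : IsCompact (inversion B '' tsupport g) :=
    hc.isCompact.image_of_continuousOn fun x hx =>
      (h.swap.contDiffAt_inversion (k := 0) (h0 hx)).continuousAt.continuousWithinAt
  have hsub : tsupport (kelvin A s g) ⊆ inversion B '' tsupport g := by
    refine closure_minimal (fun x hx => ?_) hK.isClosed
    refine ⟨inversion A x, subset_tsupport _ fun hx0 => hx ?_, h.inversion_inversion x⟩
    simp [kelvin, hx0]
  refine ⟨hK.of_isClosed_subset (isClosed_tsupport _) hsub, hsub.trans ?_⟩
  rintro _ ⟨y, hy, rfl⟩
  exact h.swap.inversion_ne_zero (h0 hy)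

lemma contDiff_kelvin (s : ℝ) {k : WithTop ℕ∞} {g : E → ℝ} (hg : ContDiff ℝ k g)
    (hc : HasCompactSupport g) (h0 : tsupport g ⊆ {0}ᶜ) : ContDiff ℝ k (kelvin A s g) := by
  refine contDiff_iff_contDiffAt.2 fun x => ?_
  by_cases hx : x ∈ tsupport (kelvin A s g)
  · exact h.contDiffAt_kelvin ((h.hasCompactSupport_kelvin s hc h0).2 hx) s hg
  · exact contDiffAt_const.congr_of_eventuallyEq (notMem_tsupport_iff_eventuallyEq.1 hx)

/-- The pointwise Kelvin identity: the energy density of two Kelvin transforms is the transported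
energy density up to a divergence. -/
lemma inner_gradient_kelvin [CompleteSpace E] {x : E} (hx : x ≠ 0) (s : ℝ) {u ψ : E → ℝ}
    (hu : DifferentiableAt ℝ u (inversion A x)) (hψ : DifferentiableAt ℝ ψ (inversion A x)) :
    ⟪B (gradient (kelvin A s u) x), gradient (kelvin A s ψ) x⟫
      = ⟪A x, x⟫ ^ (-(2 * s + 2))
          * ⟪A (gradient u (inversion A x)), gradient ψ (inversion A x)⟫
        - 2 * s * (⟪x, gradient (kelvin A (2 * s + 1) (u * ψ)) x⟫
          + (2 * s + 2) * kelvin A (2 * s + 1) (u * ψ) x) := by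
  have hq := h.pos x hx
  have hm : gradient (u * ψ) (inversion A x) = u (inversion A x) • gradient ψ (inversion A x)
      + ψ (inversion A x) • gradient u (inversion A x) := by
    refine HasGradientAt.gradient (HasFDerivAt.congr_fderiv (hu.hasFDerivAt.mul hψ.hasFDerivAt) ?_)
    simp
  rw [(h.hasGradientAt_kelvin hx s hu).gradient, (h.hasGradientAt_kelvin hx s hψ).gradient,
    (h.hasGradientAt_kelvin hx (2 * s + 1) (hu.mul hψ)).gradient, hm, kelvin]
  have e1 : ⟪A x, x⟫ ^ (-(2 * s + 1)) = ⟪A x, x⟫ ^ (-(2 * s + 2)) * ⟪A x, x⟫ := by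
    rw [← Real.rpow_add_one hq.ne']; ring_nf
  have e2 : ⟪A x, x⟫ ^ (-(2 * s + 1) - 1) = ⟪A x, x⟫ ^ (-(2 * s + 2)) := by ring_nf
  have e3 : ⟪A x, x⟫ ^ (-s - 1) * ⟪A x, x⟫ ^ (-s - 1) = ⟪A x, x⟫ ^ (-(2 * s + 2)) := by
    rw [← Real.rpow_add hq]; ring_nf
  rw [e1, e2, ← e3]
  generalize gradient u (inversion A x) = p
  generalize gradient ψ (inversion A x) = p'
  have c1 : ⟪x, A p'⟫ = ⟪A x, p'⟫ := (h.symm x p').symm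
  have c2 : ⟪x, A p⟫ = ⟪A x, p⟫ := (h.symm x p).symm
  have c3 : ⟪p, A x⟫ = ⟪A x, p⟫ := real_inner_comm _ _
  have c4 : ⟪x, A x⟫ = ⟪A x, x⟫ := real_inner_comm _ _
  have c5 : ⟪p, A p'⟫ = ⟪A p, p'⟫ := (h.symm p p').symm
  simp only [map_smul, map_sub, map_add, h.left_inv, inner_sub_left, inner_sub_right,
    inner_add_right, inner_smul_left, inner_smul_right, conj_trivial, c1, c2, c3, c4, c5,
    Pi.mul_apply]
  field_simp
  ring

lemma det_ne_zero : A.det ≠ 0 := fun h0 => by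
  have : A.toLinearMap ∘ₗ B.toLinearMap = LinearMap.id := LinearMap.ext h.right_inv
  have := congrArg LinearMap.det this
  rw [LinearMap.det_comp, LinearMap.det_id] at this
  rw [ContinuousLinearMap.det] at h0
  simp [h0] at this

section Measure

variable [FiniteDimensional ℝ E]

lemma abs_det_inversionDeriv {x : E} (hx : x ≠ 0) :
    |(inversionDeriv A x).det| = (⟪A x, x⟫ ^ Module.finrank ℝ E)⁻¹ * |A.det| := by
  have hq := h.pos x hx
  set P : E →L[ℝ] E :=
    ContinuousLinearMap.id ℝ E - (2 * (⟪A x, x⟫)⁻¹) • (innerSL ℝ (A x)).smulRight x with hP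
  have hPP : P.toLinearMap ∘ₗ P.toLinearMap = LinearMap.id := by
    ext v
    simp [hP, inner_sub_right, inner_smul_right]
    field_simp
    module
  have hdet : |LinearMap.det P.toLinearMap| = 1 := by
    have := congrArg LinearMap.det hPP
    rw [LinearMap.det_comp, LinearMap.det_id, ← sq] at this
    exact (pow_eq_one_iff_of_nonneg (abs_nonneg _) two_ne_zero).1 (by rwa [sq_abs])
  have e : (inversionDeriv A x).toLinearMap
      = (⟪A x, x⟫)⁻¹ • (A.toLinearMap ∘ₗ P.toLinearMap) := rfl
  rw [ContinuousLinearMap.det, e, LinearMap.det_smul, LinearMap.det_comp, abs_mul, abs_mul, hdet,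
    mul_one, abs_of_pos (by positivity), inv_pow, ContinuousLinearMap.det]

variable [MeasurableSpace E] [BorelSpace E]

lemma setIntegral_comp_inversion (F : E → ℝ) :
    ∫ y in ({0}ᶜ : Set E), F y
      = |A.det| * ∫ x in ({0}ᶜ : Set E), (⟪A x, x⟫ ^ Module.finrank ℝ E)⁻¹ * F (inversion A x) := by
  have hs : MeasurableSet ({0}ᶜ : Set E) := (measurableSet_singleton 0).compl
  have := integral_image_eq_integral_abs_det_fderiv_smul volume hs
    (fun x hx => (h.hasFDerivAt_inversion hx).hasFDerivWithinAt) h.inversion_injective.injOn F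
  rw [h.image_inversion] at this
  rw [this, ← integral_const_mul]
  refine setIntegral_congr_fun hs fun x hx => ?_
  simp only [h.abs_det_inversionDeriv hx, smul_eq_mul]
  ring

lemma integrableOn_comp_inversion {F : E → ℝ} (hF : Integrable F) :
    IntegrableOn (fun x => (⟪A x, x⟫ ^ Module.finrank ℝ E)⁻¹ * F (inversion A x)) {0}ᶜ := by
  have hs : MeasurableSet ({0}ᶜ : Set E) := (measurableSet_singleton 0).compl
  have := (integrableOn_image_iff_integrableOn_abs_det_fderiv_smul volume hs
    (fun x hx => (h.hasFDerivAt_inversion hx).hasFDerivWithinAt)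
    h.inversion_injective.injOn F).1 hF.integrableOn
  refine IntegrableOn.congr_fun (this.const_mul |A.det|⁻¹) (fun x hx => ?_) hs
  have := abs_pos.2 h.det_ne_zero
  simp only [h.abs_det_inversionDeriv hx, smul_eq_mul]
  field_simp

/-- The Kelvin transform with the critical exponent preserves weak solutions away from the
origin. -/
theorem weak_kelvin [Nontrivial E] {s : ℝ} (hs : 2 * s + 2 = Module.finrank ℝ E) {u f : E → ℝ}
    (hu : ContDiff ℝ 1 u)
    (hweak : ∀ φ : E → ℝ, ContDiff ℝ (⊤ : ℕ∞) φ → HasCompactSupport φ →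
      ∫ x, ⟪A (gradient u x), gradient φ x⟫ = ∫ x, f x * φ x)
    {φ : E → ℝ} (hφ : ContDiff ℝ (⊤ : ℕ∞) φ) (hc : HasCompactSupport φ)
    (h0 : tsupport φ ⊆ {0}ᶜ) :
    ∫ x, ⟪B (gradient (kelvin A s u) x), gradient φ x⟫
      = ∫ x, f (inversion A x) / ⟪A x, x⟫ ^ (s + 2) * φ x := by
  have hms : MeasurableSet ({0}ᶜ : Set E) := (measurableSet_singleton 0).compl
  have hoff (F : E → ℝ) : ∫ x in ({0}ᶜ : Set E), F x = ∫ x, F x := by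
    rw [Measure.restrict_eq_self_of_ae_mem]
    exact compl_mem_ae_iff.2 (measure_singleton 0)
  have hφ0 : φ 0 = 0 := image_eq_zero_of_notMem_tsupport fun hx => h0 hx rfl
  set ψ := kelvin B s φ with hψdef
  have hφψ : kelvin A s ψ = φ := h.kelvin_kelvin s hφ0
  have hψ : ContDiff ℝ (⊤ : ℕ∞) ψ := h.swap.contDiff_kelvin s hφ hc h0
  obtain ⟨hψc, hψ0⟩ := h.swap.hasCompactSupport_kelvin s hc h0
  have hψ1 : ContDiff ℝ 1 ψ := hψ.of_le (by exact_mod_cast le_top)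
  set G := kelvin A (2 * s + 1) (u * ψ) with hGdef
  have hm0 : tsupport (u * ψ) ⊆ {0}ᶜ := (tsupport_mul_subset_right).trans hψ0
  have hG : ContDiff ℝ 1 G := h.contDiff_kelvin _ (hu.mul hψ1) hψc.mul_left hm0
  have hGc : HasCompactSupport G := (h.hasCompactSupport_kelvin _ hψc.mul_left hm0).1
  have hGi : Integrable G := hG.continuous.integrable_of_hasCompactSupport hGc
  have hdiv : Integrable fun x => ⟪x, gradient G x⟫ + (2 * s + 2) * G x :=
    (integrable_inner_gradient hG hGc).add (hGi.const_mul _)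
  have hdiv0 : ∫ x, (⟪x, gradient G x⟫ + (2 * s + 2) * G x) = 0 := by
    rw [integral_add (integrable_inner_gradient hG hGc) (hGi.const_mul _),
      integral_inner_gradient hG hGc, integral_const_mul, hs]
    ring
  have hpow (x : E) (hx : x ≠ 0) :
      (⟪A x, x⟫ ^ Module.finrank ℝ E)⁻¹ = ⟪A x, x⟫ ^ (-(2 * s + 2)) := by
    rw [hs, Real.rpow_neg (h.pos x hx).le, Real.rpow_natCast]
  have hF : Integrable fun y => ⟪A (gradient u y), gradient ψ y⟫ :=
    ((A.continuous.comp (continuous_gradient hu)).inner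
      (continuous_gradient hψ1)).integrable_of_hasCompactSupport
      ((hasCompactSupport_gradient hψc).mono fun x hx hx0 =>
        hx ((congrArg _ hx0).trans (inner_zero_right _)))
  have hdet := abs_pos.2 h.det_ne_zero
  have key : ∫ x in ({0}ᶜ : Set E), ⟪B (gradient (kelvin A s u) x), gradient φ x⟫
      = ∫ x in ({0}ᶜ : Set E), (⟪A x, x⟫ ^ Module.finrank ℝ E)⁻¹
          * ⟪A (gradient u (inversion A x)), gradient ψ (inversion A x)⟫ := by
    calc _ = ∫ x in ({0}ᶜ : Set E), ((⟪A x, x⟫ ^ Module.finrank ℝ E)⁻¹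
              * ⟪A (gradient u (inversion A x)), gradient ψ (inversion A x)⟫
            - 2 * s * (⟪x, gradient G x⟫ + (2 * s + 2) * G x)) := by
          refine setIntegral_congr_fun hms fun x hx => ?_
          rw [hpow x hx, hGdef, ← h.inner_gradient_kelvin hx s
            (hu.differentiable one_ne_zero _) (hψ1.differentiable one_ne_zero _), hφψ]
      _ = _ := by
          rw [integral_sub (h.integrableOn_comp_inversion hF) (hdiv.const_mul _).integrableOn,
            hoff (fun x => 2 * s * (⟪x, gradient G x⟫ + (2 * s + 2) * G x)),
            integral_const_mul, hdiv0, mul_zero, sub_zero]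
  have hw := hweak ψ hψ hψc
  rw [← hoff, ← hoff (fun x => f x * ψ x), h.setIntegral_comp_inversion,
    h.setIntegral_comp_inversion (fun x => f x * ψ x)] at hw
  rw [← hoff, key, mul_left_cancel₀ hdet.ne' hw, ← hoff (fun x => _ * φ x)]
  refine setIntegral_congr_fun hms fun x hx => ?_
  have hq := h.pos x hx
  have hψx : ψ (inversion A x) = φ x * ⟪A x, x⟫ ^ s := by
    rw [hψdef, kelvin, h.inversion_inversion, h.inner_inversion, Real.inv_rpow hq.le,
      Real.rpow_neg hq.le, inv_inv]
  rw [hpow x hx, hψx, div_eq_mul_inv, ← Real.rpow_neg hq.le]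
  have : ⟪A x, x⟫ ^ (-(s + 2)) = ⟪A x, x⟫ ^ (-(2 * s + 2)) * ⟪A x, x⟫ ^ s := by
    rw [← Real.rpow_add hq]; ring_nf
  rw [this]
  ring

end Measure

end IsPosInversePair

end AnisotropicKelvin

/-- Proposition A, C¹ version: Let `u : ℝⁿ → ℝ` be `C¹` and `f` continuous
with `∫ ⟨M∇u, ∇φ⟩ = ∫ f φ` for all smooth compactly supported `φ`. With `q(x) = ⟨Mx, x⟩`,
`T_H(x) = Mx/q(x)` and `û(x) = u(T_H(x)) q(x)^{-(n-2)/2}`, for every smooth `φ` whose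
compact support is contained in `ℝⁿ \ {0}`:
`∫ ⟨M⁻¹∇û, ∇φ⟩ = ∫ (f(T_H(x))/q(x)^{(n+2)/2}) φ(x)`, i.e. `û` weakly solves
`−Δ^{H*} û = (f ∘ T_H)/H^{n+2}` in `ℝⁿ \ {0}`. -/
theorem stmt_14 {n : ℕ} (hn : 2 ≤ n)
    (M : Matrix (Fin n) (Fin n) ℝ) (hM : M.PosDef)
    (u : EuclideanSpace ℝ (Fin n) → ℝ) (hu : ContDiff ℝ 1 u)
    (f : EuclideanSpace ℝ (Fin n) → ℝ) (hf : Continuous f)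
    (hweak : ∀ φ : EuclideanSpace ℝ (Fin n) → ℝ, ContDiff ℝ (⊤ : ℕ∞) φ → HasCompactSupport φ →
      ∫ x, ⟪Matrix.toEuclideanLin M (gradient u x), gradient φ x⟫ = ∫ x, f x * φ x)
    (q : EuclideanSpace ℝ (Fin n) → ℝ)
    (hq : q = fun x => ⟪Matrix.toEuclideanLin M x, x⟫)
    (TH : EuclideanSpace ℝ (Fin n) → EuclideanSpace ℝ (Fin n))
    (hTH : TH = fun x => (q x)⁻¹ • Matrix.toEuclideanLin M x)
    (uhat : EuclideanSpace ℝ (Fin n) → ℝ)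
    (huhat : uhat = fun x => u (TH x) * q x ^ (-(((n : ℝ) - 2) / 2))) :
    ∀ φ : EuclideanSpace ℝ (Fin n) → ℝ, ContDiff ℝ (⊤ : ℕ∞) φ → HasCompactSupport φ →
      tsupport φ ⊆ ({0}ᶜ : Set (EuclideanSpace ℝ (Fin n))) →
      ∫ x, ⟪Matrix.toEuclideanLin M⁻¹ (gradient uhat x), gradient φ x⟫
        = ∫ x, (f (TH x) / q x ^ (((n : ℝ) + 2) / 2)) * φ x := by
  intro φ hφ hc h0
  have : Nontrivial (EuclideanSpace ℝ (Fin n)) :=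
    Module.nontrivial_of_finrank_pos (R := ℝ) (by simp; omega)
  let A := (Matrix.toEuclideanLin M).toContinuousLinearMap
  let B := (Matrix.toEuclideanLin M⁻¹).toContinuousLinearMap
  have hdet : IsUnit M.det := (Matrix.isUnit_iff_isUnit_det M).1 hM.isUnit
  have h : AnisotropicKelvin.IsPosInversePair A B :=
    { symm := Matrix.isSymmetric_toEuclideanLin_iff.2 hM.1
      pos := fun x hx => by
        have := hM.dotProduct_mulVec_pos (x := x.ofLp) (by simpa using hx)
        simpa [A, EuclideanSpace.inner_eq_star_dotProduct, Matrix.toLpLin_apply] using this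
      left_inv := fun x => by
        simp [A, B, Matrix.toLpLin_apply, Matrix.nonsing_inv_mul _ hdet]
      right_inv := fun x => by
        simp [A, B, Matrix.toLpLin_apply, Matrix.mul_nonsing_inv _ hdet] }
  have hT : TH = AnisotropicKelvin.inversion A := by rw [hTH, hq]; rfl
  have hU : uhat = AnisotropicKelvin.kelvin A (((n : ℝ) - 2) / 2) u := by
    rw [huhat, hT, hq]; rfl
  have key := h.weak_kelvin (s := ((n : ℝ) - 2) / 2) (by simp; ring) hu hweak hφ hc h0
  rw [show ((n : ℝ) - 2) / 2 + 2 = ((n : ℝ) + 2) / 2 by ring] at key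
  rw [hU, hT, hq]
  exact key
end

section
/- (Proposition B, C¹ version.) Let n ≥ 2, let u : ℝⁿ → ℝ be continuously differentiable and let g : ℝⁿ → ℝ be continuous. Suppose that for every smooth compactly supported φ : ℝⁿ → ℝ, ∫_{ℝⁿ} ⟨M∇u, ∇u⟩^{(n-2)/2} ⟨M∇u, ∇φ⟩ dx = ∫_{ℝⁿ} g φ dx. Define q(x) = ⟨Mx, x⟩, T_H(x) = Mx/q(x), and u*(x) = u(T_H(x)) on ℝⁿ \ {0}. Then for every smooth φ : ℝⁿ → ℝ whose compact support is contained in ℝⁿ \ {0}, ∫_{ℝⁿ} ⟨M⁻¹∇u*, ∇u*⟩^{(n-2)/2} ⟨M⁻¹∇u*, ∇φ⟩ dx = ∫_{ℝⁿ} (g(T_H(x)) / q(x)^{n}) φ(x) dx; that is, u* weakly solves −Δ_n^{H*} u* = (g ∘ T_H)/H^{2n} in ℝⁿ \ {0}. -/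
open MeasureTheory
open scoped RealInnerProductSpace

section FinslerInversion

variable {E : Type*} [NormedAddCommGroup E] [InnerProductSpace ℝ E]

/-- The inversion `x ↦ A x / ⟪A x, x⟫` attached to a linear operator `A`. -/
noncomputable def finslerInversion (A : E →L[ℝ] E) (x : E) : E := (⟪A x, x⟫)⁻¹ • A x

/-- The derivative of `finslerInversion A` at `x`, for symmetric `A` and `⟪A x, x⟫ ≠ 0`. -/
noncomputable def finslerInversionDeriv (A : E →L[ℝ] E) (x : E) : E →L[ℝ] E :=
  (⟪A x, x⟫)⁻¹ • (A - (2 * (⟪A x, x⟫)⁻¹) • (innerSL ℝ (A x)).smulRight (A x))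

lemma finslerInversionDeriv_apply (A : E →L[ℝ] E) (x v : E) :
    finslerInversionDeriv A x v =
      (⟪A x, x⟫)⁻¹ • (A v - (2 * (⟪A x, x⟫)⁻¹) • ⟪A x, v⟫ • A x) := by
  simp [finslerInversionDeriv]

lemma hasFDerivAt_finslerInversion {A : E →L[ℝ] E} (hA : ∀ x y, ⟪A x, y⟫ = ⟪x, A y⟫) {x : E}
    (hx : ⟪A x, x⟫ ≠ 0) :
    HasFDerivAt (finslerInversion A) (finslerInversionDeriv A x) x := by
  have hq : HasFDerivAt (fun x : E => ⟪A x, x⟫) _ x :=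
    (A.hasFDerivAt (x := x)).inner ℝ (hasFDerivAt_id x)
  have hi := ((hasDerivAt_inv hx).comp_hasFDerivAt (f := fun x : E => ⟪A x, x⟫) x hq).smul
    (A.hasFDerivAt (x := x))
  refine hi.congr_fderiv ?_
  ext v
  have hv : ⟪A v, x⟫ = ⟪A x, v⟫ := by rw [hA, real_inner_comm]
  simp only [finslerInversionDeriv_apply]
  simp [hv, smul_smul, sub_eq_add_neg, ← neg_smul]
  congr 1
  field_simp
  ring

lemma contDiffAt_finslerInversion {A : E →L[ℝ] E} {x : E} (hx : ⟪A x, x⟫ ≠ 0)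
    {m : WithTop ℕ∞} : ContDiffAt ℝ m (finslerInversion A) x :=
  ((A.contDiff.contDiffAt.inner ℝ contDiffAt_id).inv hx).smul A.contDiff.contDiffAt

lemma finslerInversion_finslerInversion {A B : E →L[ℝ] E} (hBA : ∀ x, B (A x) = x) {x : E}
    (hx : ⟪A x, x⟫ ≠ 0) : finslerInversion B (finslerInversion A x) = x := by
  have h : ⟪x, A x⟫ ≠ 0 := by rwa [real_inner_comm]
  simp only [finslerInversion, map_smul, hBA, inner_smul_left, inner_smul_right, smul_smul]
  rw [real_inner_comm x (A x)]
  simp only [conj_trivial]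
  field_simp
  simp

lemma finslerInversion_zero (A : E →L[ℝ] E) : finslerInversion A 0 = 0 := by
  simp [finslerInversion]

lemma finslerInversion_ne_zero {A : E →L[ℝ] E} {x : E} (hx : ⟪A x, x⟫ ≠ 0) :
    finslerInversion A x ≠ 0 := by
  refine smul_ne_zero (inv_ne_zero hx) fun h => hx ?_
  simp [h]

lemma inner_finslerInversionDeriv_left {A : E →L[ℝ] E} (hA : ∀ x y, ⟪A x, y⟫ = ⟪x, A y⟫)
    (x p v : E) :
    ⟪finslerInversionDeriv A x p, v⟫ = ⟪p, finslerInversionDeriv A x v⟫ := by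
  simp only [finslerInversionDeriv_apply, inner_smul_left, inner_smul_right, inner_sub_left,
    inner_sub_right, conj_trivial, hA p v, real_inner_comm p (A x)]
  ring

lemma inner_finslerInversionDeriv {A B : E →L[ℝ] E} (hA : ∀ x y, ⟪A x, y⟫ = ⟪x, A y⟫)
    (hBA : ∀ x, B (A x) = x) {x : E} (hx : ⟪A x, x⟫ ≠ 0) (p r : E) :
    ⟪B (finslerInversionDeriv A x p), finslerInversionDeriv A x r⟫ =
      ⟪A p, r⟫ / ⟪A x, x⟫ ^ 2 := by
  have h₁ : ⟪p, A x⟫ = ⟪A x, p⟫ := real_inner_comm _ _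
  have h₂ : ⟪x, A r⟫ = ⟪A x, r⟫ := (hA x r).symm
  have h₃ : ⟪x, A x⟫ = ⟪A x, x⟫ := real_inner_comm _ _
  simp only [finslerInversionDeriv_apply, map_smul, map_sub, hBA, inner_smul_left,
    inner_smul_right, inner_sub_left, inner_sub_right, conj_trivial, h₁, h₂, h₃, ← hA p r]
  field_simp
  ring

lemma tsupport_comp_finslerInversion_subset {A B : E →L[ℝ] E}
    (hAB : ∀ x, A (B x) = x) (hA0 : ∀ x, x ≠ 0 → 0 < ⟪A x, x⟫) (hB0 : ∀ x, x ≠ 0 → 0 < ⟪B x, x⟫)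
    {φ : E → ℝ} (hc : HasCompactSupport φ) (h0 : tsupport φ ⊆ {0}ᶜ) :
    IsCompact (finslerInversion A '' tsupport φ) ∧
      tsupport (fun y => φ (finslerInversion B y)) ⊆ finslerInversion A '' tsupport φ := by
  have hK : IsCompact (finslerInversion A '' tsupport φ) :=
    hc.isCompact.image_of_continuousOn fun x hx =>
      (contDiffAt_finslerInversion (m := 0)
        (hA0 x (h0 hx)).ne').continuousAt.continuousWithinAt
  refine ⟨hK, closure_minimal (fun y hy => ?_) hK.isClosed⟩
  have hy' : finslerInversion B y ∈ tsupport φ := subset_tsupport φ hy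
  have hy0 : y ≠ 0 := by
    rintro rfl
    exact h0 hy' (finslerInversion_zero B)
  exact ⟨_, hy', finslerInversion_finslerInversion hAB (hB0 y hy0).ne'⟩

variable [FiniteDimensional ℝ E]

lemma abs_det_finslerInversionDeriv (A : E →L[ℝ] E) {x : E} (hx : 0 < ⟪A x, x⟫) :
    |(finslerInversionDeriv A x).det| =
      |A.det| * (⟪A x, x⟫ ^ Module.finrank ℝ E)⁻¹ := by
  set R : E →ₗ[ℝ] E := LinearMap.id -
    (2 * (⟪A x, x⟫)⁻¹) • ((innerSL ℝ (A x)).smulRight x : E →L[ℝ] E).toLinearMap with hR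
  have hRv : ∀ v, R v = v - (2 * (⟪A x, x⟫)⁻¹ * ⟪A x, v⟫) • x := fun v => by
    simp [hR, smul_smul]
  have hRR : R ∘ₗ R = LinearMap.id := by
    ext v
    simp only [LinearMap.comp_apply, hRv, LinearMap.id_apply, inner_sub_right, inner_smul_right]
    rw [sub_sub, ← add_smul]
    convert sub_zero v
    convert zero_smul ℝ x
    field_simp
    ring
  have hdet : |LinearMap.det R| = 1 := by
    have h := congrArg LinearMap.det hRR
    rw [LinearMap.det_comp, LinearMap.det_id] at h
    exact (mul_self_eq_one_iff.1 h).elim (by simp +contextual) (by simp +contextual)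
  have hfac : (finslerInversionDeriv A x).toLinearMap =
      (⟪A x, x⟫)⁻¹ • (A.toLinearMap ∘ₗ R) := by
    ext v
    simp [finslerInversionDeriv_apply, hRv, smul_smul]
  rw [ContinuousLinearMap.det, hfac, LinearMap.det_smul, LinearMap.det_comp, abs_mul, abs_mul,
    hdet, ContinuousLinearMap.det, abs_of_nonneg (by positivity)]
  ring

lemma gradient_comp_finslerInversion {A : E →L[ℝ] E} (hA : ∀ x y, ⟪A x, y⟫ = ⟪x, A y⟫)
    {x : E} (hx : ⟪A x, x⟫ ≠ 0) {f : E → ℝ}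
    (hf : DifferentiableAt ℝ f (finslerInversion A x)) :
    gradient (fun y => f (finslerInversion A y)) x =
      finslerInversionDeriv A x (gradient f (finslerInversion A x)) := by
  refine HasGradientAt.gradient ?_
  rw [hasGradientAt_iff_hasFDerivAt]
  refine (hf.hasGradientAt.hasFDerivAt.comp x (hasFDerivAt_finslerInversion hA hx)).congr_fderiv ?_
  ext v
  simp [inner_finslerInversionDeriv_left hA]

variable [MeasurableSpace E] [BorelSpace E] [Nontrivial E]

lemma integral_comp_finslerInversion {A B : E →L[ℝ] E} (hA : ∀ x y, ⟪A x, y⟫ = ⟪x, A y⟫)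
    (hBA : ∀ x, B (A x) = x) (hAB : ∀ x, A (B x) = x) (hA0 : ∀ x, x ≠ 0 → 0 < ⟪A x, x⟫)
    (hB0 : ∀ x, x ≠ 0 → 0 < ⟪B x, x⟫) (G : E → ℝ) :
    ∫ y, G y = |A.det| * ∫ x, (⟪A x, x⟫ ^ Module.finrank ℝ E)⁻¹ * G (finslerInversion A x) := by
  have hs : MeasurableSet ({0}ᶜ : Set E) := (measurableSet_singleton 0).compl
  have hae : ({0}ᶜ : Set E) =ᵐ[volume] Set.univ := by
    rw [ae_eq_univ, compl_compl]
    exact measure_singleton 0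
  have himg : finslerInversion A '' {0}ᶜ = ({0}ᶜ : Set E) := by
    ext y
    refine ⟨?_, fun hy => ⟨finslerInversion B y, finslerInversion_ne_zero (hB0 y hy).ne',
      finslerInversion_finslerInversion hAB (hB0 y hy).ne'⟩⟩
    rintro ⟨x, hx, rfl⟩
    exact finslerInversion_ne_zero (hA0 x hx).ne'
  have hinj : Set.InjOn (finslerInversion A) {0}ᶜ :=
    Set.LeftInvOn.injOn (f₁' := finslerInversion B) fun x hx =>
      finslerInversion_finslerInversion hBA (hA0 x hx).ne'
  have h := integral_image_eq_integral_abs_det_fderiv_smul volume hs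
    (fun x hx => (hasFDerivAt_finslerInversion hA (hA0 x hx).ne').hasFDerivWithinAt) hinj G
  rw [himg, setIntegral_congr_set hae, setIntegral_univ] at h
  rw [h, ← integral_const_mul, ← setIntegral_univ (μ := volume), ← setIntegral_congr_set hae]
  refine setIntegral_congr_fun hs fun x hx => ?_
  simp only [abs_det_finslerInversionDeriv A (hA0 x hx), smul_eq_mul, mul_assoc]

/-- Weak solutions of the `A`-Finsler `n`-Laplace equation transform covariantly under
`finslerInversion A`, where `n` is the dimension and `B` is the inverse of `A`. -/
lemma weak_solution_comp_finslerInversion {A B : E →L[ℝ] E}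
    (hA : ∀ x y, ⟪A x, y⟫ = ⟪x, A y⟫)
    (hBA : ∀ x, B (A x) = x) (hAB : ∀ x, A (B x) = x) (hA0 : ∀ x, x ≠ 0 → 0 < ⟪A x, x⟫)
    (hB0 : ∀ x, x ≠ 0 → 0 < ⟪B x, x⟫) {n : ℕ} (hn : Module.finrank ℝ E = n)
    {u g : E → ℝ} (hu : ContDiff ℝ 1 u)
    (hweak : ∀ φ : E → ℝ, ContDiff ℝ (⊤ : ℕ∞) φ → HasCompactSupport φ →
      ∫ x, ⟪A (gradient u x), gradient u x⟫ ^ (((n : ℝ) - 2) / 2)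
        * ⟪A (gradient u x), gradient φ x⟫ = ∫ x, g x * φ x)
    {φ : E → ℝ} (hφ : ContDiff ℝ (⊤ : ℕ∞) φ) (hc : HasCompactSupport φ)
    (h0 : tsupport φ ⊆ {0}ᶜ) :
    ∫ x, ⟪B (gradient (fun y => u (finslerInversion A y)) x),
          gradient (fun y => u (finslerInversion A y)) x⟫ ^ (((n : ℝ) - 2) / 2)
        * ⟪B (gradient (fun y => u (finslerInversion A y)) x), gradient φ x⟫ =
      ∫ x, (g (finslerInversion A x) / ⟪A x, x⟫ ^ n) * φ x := by
  set ψ : E → ℝ := fun y => φ (finslerInversion B y) with hψ_def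
  obtain ⟨hK, hψK⟩ := tsupport_comp_finslerInversion_subset hAB hA0 hB0 hc h0
  have hψc : HasCompactSupport ψ := hK.of_isClosed_subset (isClosed_tsupport ψ) hψK
  have hψ : ContDiff ℝ (⊤ : ℕ∞) ψ := contDiff_iff_contDiffAt.2 fun y => by
    by_cases hy : y ∈ tsupport ψ
    swap
    · exact contDiffAt_const.congr_of_eventuallyEq (notMem_tsupport_iff_eventuallyEq.1 hy)
    obtain ⟨x, hx, rfl⟩ := hψK hy
    exact hφ.contDiffAt.comp _ (contDiffAt_finslerInversion
      (hB0 _ (finslerInversion_ne_zero (hA0 x (h0 hx)).ne')).ne')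
  have hψφ : ∀ x, x ≠ 0 → ψ (finslerInversion A x) = φ x := fun x hx => by
    simp only [hψ_def, finslerInversion_finslerInversion hBA (hA0 x hx).ne']
  have hgradφ : ∀ x, x ≠ 0 → gradient φ x =
      finslerInversionDeriv A x (gradient ψ (finslerInversion A x)) := fun x hx => by
    rw [← gradient_comp_finslerInversion hA (hA0 x hx).ne'
      (hψ.differentiable (by simp)).differentiableAt]
    refine Filter.EventuallyEq.gradient_eq ?_
    filter_upwards [isOpen_compl_singleton.mem_nhds hx] with y hy using (hψφ y hy).symm
  have hne : ∀ᵐ x : E, x ≠ 0 := by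
    simp [ae_iff]
  have hdet : |A.det| ≠ 0 := by
    have hcomp : A.toLinearMap ∘ₗ B.toLinearMap = LinearMap.id := by
      ext v
      simp [hAB]
    have h := congrArg LinearMap.det hcomp
    rw [LinearMap.det_comp, LinearMap.det_id] at h
    exact abs_ne_zero.2 (left_ne_zero_of_mul_eq_one h)
  have hApos : ∀ p, 0 ≤ ⟪A p, p⟫ := fun p => by
    rcases eq_or_ne p 0 with rfl | hp
    · simp
    · exact (hA0 p hp).le
  have key := hweak ψ hψ hψc
  rw [integral_comp_finslerInversion hA hBA hAB hA0 hB0,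
    integral_comp_finslerInversion hA hBA hAB hA0 hB0 (fun x => g x * ψ x)] at key
  convert mul_left_cancel₀ hdet key using 1
  · refine integral_congr_ae ?_
    filter_upwards [hne] with x hx
    have hq := hA0 x hx
    rw [gradient_comp_finslerInversion hA hq.ne' (hu.differentiable (by simp)).differentiableAt,
      hgradφ x hx, inner_finslerInversionDeriv hA hBA hq.ne',
      inner_finslerInversionDeriv hA hBA hq.ne', Real.div_rpow (hApos _) (by positivity), hn]
    have hpow : (⟪A x, x⟫ ^ 2) ^ (((n : ℝ) - 2) / 2) * ⟪A x, x⟫ ^ 2 = ⟪A x, x⟫ ^ n := by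
      rw [← Real.rpow_natCast _ 2, ← Real.rpow_mul hq.le, ← Real.rpow_add hq,
        ← Real.rpow_natCast _ n]
      congr 1
      push_cast
      ring
    rw [← hpow, div_mul_div_comm, div_eq_inv_mul]
  · refine integral_congr_ae ?_
    filter_upwards [hne] with x hx
    rw [hψφ x hx, hn]
    ring

end FinslerInversion

/-- Proposition B, C¹ version: Let `u : ℝⁿ → ℝ` be `C¹` and `g` continuous
with `∫ ⟨M∇u, ∇u⟩^{(n-2)/2} ⟨M∇u, ∇φ⟩ = ∫ g φ` for all smooth compactly supported `φ`.
With `q(x) = ⟨Mx, x⟩`, `T_H(x) = Mx/q(x)` and `u*(x) = u(T_H(x))`, for every smooth `φ`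
whose compact support is contained in `ℝⁿ \ {0}`:
`∫ ⟨M⁻¹∇u*, ∇u*⟩^{(n-2)/2} ⟨M⁻¹∇u*, ∇φ⟩ = ∫ (g(T_H(x))/q(x)ⁿ) φ(x)`, i.e. `u*` weakly
solves `−Δ_n^{H*} u* = (g ∘ T_H)/H^{2n}` in `ℝⁿ \ {0}`. Powers are `Real.rpow`. -/
theorem stmt_15 {n : ℕ} (hn : 2 ≤ n)
    (M : Matrix (Fin n) (Fin n) ℝ) (hM : M.PosDef)
    (u : EuclideanSpace ℝ (Fin n) → ℝ) (hu : ContDiff ℝ 1 u)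
    (g : EuclideanSpace ℝ (Fin n) → ℝ) (hg : Continuous g)
    (hweak : ∀ φ : EuclideanSpace ℝ (Fin n) → ℝ, ContDiff ℝ (⊤ : ℕ∞) φ → HasCompactSupport φ →
      ∫ x, ⟪Matrix.toEuclideanLin M (gradient u x), gradient u x⟫ ^ (((n : ℝ) - 2) / 2)
            * ⟪Matrix.toEuclideanLin M (gradient u x), gradient φ x⟫
        = ∫ x, g x * φ x)
    (q : EuclideanSpace ℝ (Fin n) → ℝ)
    (hq : q = fun x => ⟪Matrix.toEuclideanLin M x, x⟫)
    (TH : EuclideanSpace ℝ (Fin n) → EuclideanSpace ℝ (Fin n))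
    (hTH : TH = fun x => (q x)⁻¹ • Matrix.toEuclideanLin M x)
    (ustar : EuclideanSpace ℝ (Fin n) → ℝ) (hustar : ustar = fun x => u (TH x)) :
    ∀ φ : EuclideanSpace ℝ (Fin n) → ℝ, ContDiff ℝ (⊤ : ℕ∞) φ → HasCompactSupport φ →
      tsupport φ ⊆ ({0}ᶜ : Set (EuclideanSpace ℝ (Fin n))) →
      ∫ x, ⟪Matrix.toEuclideanLin M⁻¹ (gradient ustar x), gradient ustar x⟫ ^ (((n : ℝ) - 2) / 2)
            * ⟪Matrix.toEuclideanLin M⁻¹ (gradient ustar x), gradient φ x⟫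
        = ∫ x, (g (TH x) / q x ^ n) * φ x := by
  intro φ hφ hc h0
  have : Nontrivial (EuclideanSpace ℝ (Fin n)) :=
    Module.nontrivial_of_finrank_pos (R := ℝ) (by rw [finrank_euclideanSpace_fin]; omega)
  have hsymm : ∀ x y : EuclideanSpace ℝ (Fin n),
      ⟪Matrix.toEuclideanLin M x, y⟫ = ⟪x, Matrix.toEuclideanLin M y⟫ :=
    Matrix.isSymmetric_toEuclideanLin_iff.2 hM.isHermitian
  have hpos : ∀ {N : Matrix (Fin n) (Fin n) ℝ}, N.PosDef → ∀ x : EuclideanSpace ℝ (Fin n),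
      x ≠ 0 → 0 < ⟪Matrix.toEuclideanLin N x, x⟫ := fun hN x hx => by
    rw [real_inner_comm]
    have := hN.dotProduct_mulVec_pos (x := x.ofLp) (by simpa using hx)
    simpa [EuclideanSpace.inner_eq_star_dotProduct, dotProduct_comm] using this
  have hdet : IsUnit M.det := (Matrix.isUnit_iff_isUnit_det M).1 hM.isUnit
  have hBA : ∀ x, Matrix.toEuclideanLin M⁻¹ (Matrix.toEuclideanLin M x) = x := fun x => by
    simp [Matrix.toLpLin_apply, Matrix.nonsing_inv_mul M hdet]
  have hAB : ∀ x, Matrix.toEuclideanLin M (Matrix.toEuclideanLin M⁻¹ x) = x := fun x => by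
    simp [Matrix.toLpLin_apply, Matrix.mul_nonsing_inv M hdet]
  subst hustar hTH hq
  exact weak_solution_comp_finslerInversion
    (A := LinearMap.toContinuousLinearMap (Matrix.toEuclideanLin M))
    (B := LinearMap.toContinuousLinearMap (Matrix.toEuclideanLin M⁻¹))
    hsymm hBA hAB (hpos hM) (hpos hM.inv) finrank_euclideanSpace_fin hu hweak hφ hc h0
end
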